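/- Let C_V > 0 and suppose ‖V^k‖_F² ≤ C_V and that w^k = (1/ρ) λ_ex (V^k)ᵀV^k s^k (i.e., w^k equals (1/ρ) times the gradient of g with respect to s at (V^k,U^k,s^k)). Then the augmented Lagrangian is bounded below as L_ρ(V^k, U^k, s^k, w^k) ≥ ((ρ − λ_ex C_V)/2) · ‖(1/m)(U^k)ᵀ𝟙 − s^k‖₂². -/

import Mathlib

open Matrix Finset Filter Topology

noncomputable section

/-- Squared Frobenius norm of a real matrix. -/
def frobSq {a b : ℕ} (A : Matrix (Fin a) (Fin b) ℝ) : ℝ := ∑ i, ∑ j, (A i j) ^ 2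

/-- Frobenius norm of a real matrix. -/
def frobNorm {a b : ℕ} (A : Matrix (Fin a) (Fin b) ℝ) : ℝ := Real.sqrt (frobSq A)

/-- Frobenius (trace) inner product of matrices. -/
def frobInner {a b : ℕ} (A B : Matrix (Fin a) (Fin b) ℝ) : ℝ := ∑ i, ∑ j, A i j * B i j

/-- Squared Euclidean norm of a vector. -/
def vecSq {a : ℕ} (x : Fin a → ℝ) : ℝ := ∑ i, (x i) ^ 2

/-- Euclidean norm of a vector. -/
def vecNorm {a : ℕ} (x : Fin a → ℝ) : ℝ := Real.sqrt (vecSq x)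

/-- Entrywise (Hadamard) product of matrices. -/
def hprod {a b : ℕ} (A B : Matrix (Fin a) (Fin b) ℝ) : Matrix (Fin a) (Fin b) ℝ :=
  Matrix.of fun i j => A i j * B i j

/-- The iALS loss L(V,U). -/
def iALSLoss {m n d : ℕ} (R : Matrix (Fin m) (Fin n) ℝ) (α₀ : ℝ)
    (lamU : Fin m → ℝ) (lamV : Fin n → ℝ)
    (V : Matrix (Fin n) (Fin d) ℝ) (U : Matrix (Fin m) (Fin d) ℝ) : ℝ :=
  (1/2) * frobSq (hprod R (R - U * Vᵀ)) + (α₀/2) * frobSq (U * Vᵀ)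
    + (1/2) * ∑ i, lamU i * vecSq (U i) + (1/2) * ∑ j, lamV j * vecSq (V j)

/-- g(V,U,s) = L(V,U) + (λ_ex/2)‖V s‖₂². -/
def gFun {m n d : ℕ} (R : Matrix (Fin m) (Fin n) ℝ) (α₀ lamex : ℝ)
    (lamU : Fin m → ℝ) (lamV : Fin n → ℝ)
    (V : Matrix (Fin n) (Fin d) ℝ) (U : Matrix (Fin m) (Fin d) ℝ) (s : Fin d → ℝ) : ℝ :=
  iALSLoss R α₀ lamU lamV V U + (lamex/2) * vecSq (V.mulVec s)

/-- (1/m) Uᵀ 𝟙 : the average of the rows of U. -/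
def avgRow {m d : ℕ} (U : Matrix (Fin m) (Fin d) ℝ) : Fin d → ℝ :=
  fun k => (1 / (m : ℝ)) * ∑ i, U i k

/-- The augmented Lagrangian L_ρ(V,U,s,w). -/
def augL {m n d : ℕ} (R : Matrix (Fin m) (Fin n) ℝ) (α₀ lamex : ℝ)
    (lamU : Fin m → ℝ) (lamV : Fin n → ℝ) (ρ : ℝ)
    (V : Matrix (Fin n) (Fin d) ℝ) (U : Matrix (Fin m) (Fin d) ℝ) (s w : Fin d → ℝ) : ℝ :=
  gFun R α₀ lamex lamU lamV V U s + (ρ/2) * vecSq (avgRow U - s + w) - (ρ/2) * vecSq w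

/-- Gradient of g with respect to V; the j-th row is
(Σ_i R_{ij} u_i u_iᵀ + α₀ UᵀU + λ_ex s sᵀ + λ_V^{(j)} I) v_j − Σ_i R_{ij} u_i. -/
def gradV {m n d : ℕ} (R : Matrix (Fin m) (Fin n) ℝ) (α₀ lamex : ℝ)
    (lamV : Fin n → ℝ)
    (V : Matrix (Fin n) (Fin d) ℝ) (U : Matrix (Fin m) (Fin d) ℝ) (s : Fin d → ℝ) :
    Matrix (Fin n) (Fin d) ℝ :=
  Matrix.of fun j =>
    ((∑ i, R i j • vecMulVec (U i) (U i)) + α₀ • (Uᵀ * U)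
        + lamex • vecMulVec s s + (lamV j) • (1 : Matrix (Fin d) (Fin d) ℝ)).mulVec (V j)
      - ∑ i, R i j • U i

/-- Gradient of g with respect to U; the i-th row is
(Σ_j R_{ij} v_j v_jᵀ + α₀ VᵀV + λ_U^{(i)} I) u_i − Σ_j R_{ij} v_j (independent of s). -/
def gradU {m n d : ℕ} (R : Matrix (Fin m) (Fin n) ℝ) (α₀ : ℝ)
    (lamU : Fin m → ℝ)
    (V : Matrix (Fin n) (Fin d) ℝ) (U : Matrix (Fin m) (Fin d) ℝ) :
    Matrix (Fin m) (Fin d) ℝ :=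
  Matrix.of fun i =>
    ((∑ j, R i j • vecMulVec (V j) (V j)) + α₀ • (Vᵀ * V)
        + (lamU i) • (1 : Matrix (Fin d) (Fin d) ℝ)).mulVec (U i)
      - ∑ j, R i j • V j

/-- Gradient of g with respect to s: λ_ex VᵀV s (independent of U). -/
def gradS {n d : ℕ} (lamex : ℝ) (V : Matrix (Fin n) (Fin d) ℝ) (s : Fin d → ℝ) : Fin d → ℝ :=
  lamex • (Vᵀ * V).mulVec s

/-- Gradient of the augmented Lagrangian with respect to U. -/
def gradUL {m n d : ℕ} (R : Matrix (Fin m) (Fin n) ℝ) (α₀ : ℝ) (lamU : Fin m → ℝ) (ρ : ℝ)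
    (V : Matrix (Fin n) (Fin d) ℝ) (U : Matrix (Fin m) (Fin d) ℝ) (s w : Fin d → ℝ) :
    Matrix (Fin m) (Fin d) ℝ :=
  Matrix.of fun i => gradU R α₀ lamU V U i + (ρ / (m : ℝ)) • (avgRow U - s + w)

/-- Gradient of the augmented Lagrangian with respect to s:
λ_ex VᵀV s − ρ((1/m)Uᵀ𝟙 − s + w). -/
def gradSL {m n d : ℕ} (lamex ρ : ℝ)
    (V : Matrix (Fin n) (Fin d) ℝ) (U : Matrix (Fin m) (Fin d) ℝ) (s w : Fin d → ℝ) :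
    Fin d → ℝ :=
  gradS lamex V s - ρ • (avgRow U - s + w)

/-- Gradient of the augmented Lagrangian with respect to w: ρ((1/m)Uᵀ𝟙 − s). -/
def gradWL {m d : ℕ} (ρ : ℝ) (U : Matrix (Fin m) (Fin d) ℝ) (s : Fin d → ℝ) : Fin d → ℝ :=
  ρ • (avgRow U - s)

theorem vecSq_nonneg {a : ℕ} (x : Fin a → ℝ) : 0 ≤ vecSq x :=
  Finset.sum_nonneg fun _ _ => sq_nonneg _

theorem frobSq_nonneg {a b : ℕ} (A : Matrix (Fin a) (Fin b) ℝ) : 0 ≤ frobSq A :=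
  Finset.sum_nonneg fun _ _ => Finset.sum_nonneg fun _ _ => sq_nonneg _

theorem vecSq_eq_dotProduct {a : ℕ} (x : Fin a → ℝ) : vecSq x = x ⬝ᵥ x := by
  simp [vecSq, dotProduct, sq]

theorem vecSq_add {a : ℕ} (x y : Fin a → ℝ) :
    vecSq (x + y) = vecSq x + 2 * (x ⬝ᵥ y) + vecSq y := by
  simp only [vecSq_eq_dotProduct, add_dotProduct, dotProduct_add, dotProduct_comm y x]
  ring

/-- The Frobenius norm dominates the operator norm. -/
theorem vecSq_mulVec_le {a b : ℕ} (A : Matrix (Fin a) (Fin b) ℝ) (x : Fin b → ℝ) :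
    vecSq (A.mulVec x) ≤ frobSq A * vecSq x := by
  simp only [vecSq, frobSq, mulVec, dotProduct]
  rw [Finset.sum_mul]
  exact Finset.sum_le_sum fun i _ => Finset.sum_mul_sq_le_sq_mul_sq Finset.univ (A i) x

theorem iALSLoss_nonneg {m n d : ℕ} (R : Matrix (Fin m) (Fin n) ℝ) {α₀ : ℝ} (hα : 0 ≤ α₀)
    {lamU : Fin m → ℝ} {lamV : Fin n → ℝ} (hlamU : ∀ i, 0 ≤ lamU i) (hlamV : ∀ j, 0 ≤ lamV j)
    (V : Matrix (Fin n) (Fin d) ℝ) (U : Matrix (Fin m) (Fin d) ℝ) :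
    0 ≤ iALSLoss R α₀ lamU lamV V U := by
  have h₁ := frobSq_nonneg (hprod R (R - U * Vᵀ))
  have h₂ := frobSq_nonneg (U * Vᵀ)
  have h₃ : 0 ≤ ∑ i, lamU i * vecSq (U i) :=
    Finset.sum_nonneg fun i _ => mul_nonneg (hlamU i) (vecSq_nonneg _)
  have h₄ : 0 ≤ ∑ j, lamV j * vecSq (V j) :=
    Finset.sum_nonneg fun j _ => mul_nonneg (hlamV j) (vecSq_nonneg _)
  unfold iALSLoss
  positivity

theorem dotProduct_gradS {n d : ℕ} (lamex : ℝ) (V : Matrix (Fin n) (Fin d) ℝ)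
    (x s : Fin d → ℝ) :
    x ⬝ᵥ gradS lamex V s = lamex * (V.mulVec x ⬝ᵥ V.mulVec s) := by
  rw [gradS, dotProduct_smul, smul_eq_mul, ← mulVec_mulVec, dotProduct_mulVec, vecMul_transpose]

/-- Lemma: lower bound on the augmented Lagrangian. -/
theorem augL_lower_bound {m n d : ℕ} (hm : 1 ≤ m) (hn : 1 ≤ n) (hd : 1 ≤ d)
    (R : Matrix (Fin m) (Fin n) ℝ) (hR : ∀ i j, R i j = 0 ∨ R i j = 1)
    (α₀ lamex ρ : ℝ) (hα : 0 < α₀) (hlamex : 0 < lamex) (hρ0 : 0 < ρ)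
    (lamU : Fin m → ℝ) (lamV : Fin n → ℝ)
    (hlamU : ∀ i, 0 < lamU i) (hlamV : ∀ j, 0 < lamV j)
    (CV : ℝ) (hCV : 0 < CV)
    (Vk : Matrix (Fin n) (Fin d) ℝ) (Uk : Matrix (Fin m) (Fin d) ℝ)
    (sk wk : Fin d → ℝ)
    (hVkb : frobSq Vk ≤ CV)
    (hwk : wk = (1/ρ) • gradS lamex Vk sk) :
    augL R α₀ lamex lamU lamV ρ Vk Uk sk wk
      ≥ ((ρ - lamex * CV) / 2) * vecSq (avgRow Uk - sk) := by
  have hcross : ρ * ((avgRow Uk - sk) ⬝ᵥ wk)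
      = lamex * (Vk.mulVec (avgRow Uk - sk) ⬝ᵥ Vk.mulVec sk) := by
    rw [hwk, dotProduct_smul, dotProduct_gradS, smul_eq_mul]
    field_simp
  have hloss := iALSLoss_nonneg R hα.le (fun i => (hlamU i).le) (fun j => (hlamV j).le) Vk Uk
  have hbound : lamex * vecSq (Vk.mulVec (avgRow Uk - sk))
      ≤ lamex * (CV * vecSq (avgRow Uk - sk)) :=
    mul_le_mul_of_nonneg_left ((vecSq_mulVec_le _ _).trans
      (mul_le_mul_of_nonneg_right hVkb (vecSq_nonneg _))) hlamex.le
  have hsq := mul_nonneg hlamex.le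
    (vecSq_nonneg (Vk.mulVec (avgRow Uk - sk) + Vk.mulVec sk))
  rw [vecSq_add] at hsq
  rw [augL, gFun, vecSq_add]
  linarith
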